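/- arXiv:2305.20008 — 5 statements merged into one kernel-verified Lean document; each statement's English description precedes it below -/
import Mathlib

section
/- Let q be a prime power and m, n ≥ 0, and let α_{m,n} be the number of ordered pairs (f, g) with f, g ∈ F_q[X] monic, deg f = m, deg g = n, and gcd(f, g) = 1. Then α_{m,n} = q^n if m = 0, and α_{m,n} = q^{m+n}(1 - q^{-1}) if m > 0 and n > 0. -/
open Polynomial

theorem card_monic_natDegree_eq (F : Type*) [Field F] [Fintype F] (n : ℕ) :
    Nat.card {p : F[X] // p.Monic ∧ p.natDegree = n} = Fintype.card F ^ n := by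
  rw [Nat.card_congr ((monicEquivDegreeLT n).trans (degreeLTEquiv F n).toEquiv)]
  simp

/-- Triples `(h, a, b)` of monic polynomials with `a`, `b` coprime, `h * a` of degree `m` and
`h * b` of degree `n`. -/
def gcdTriples (F : Type*) [Field F] (m n : ℕ) : Set (F[X] × F[X] × F[X]) :=
  {t | t.1.Monic ∧ t.2.1.Monic ∧ t.2.2.Monic ∧ t.1.natDegree + t.2.1.natDegree = m ∧
    t.1.natDegree + t.2.2.natDegree = n ∧ IsCoprime t.2.1 t.2.2}

theorem dvd_of_mul_eq_mul_of_isCoprime {R : Type*} [CommRing R] {h k a b c d : R}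
    (hab : IsCoprime a b) (h₁ : h * a = k * c) (h₂ : h * b = k * d) : k ∣ h := by
  obtain ⟨u, v, huv⟩ := hab
  exact ⟨u * c + v * d, by linear_combination -h * huv + u * h₁ + v * h₂⟩

theorem exists_monic_mul_isCoprime {F : Type*} [Field F] {f g : F[X]} (hf : f.Monic)
    (hg : g.Monic) : ∃ h a b : F[X], h.Monic ∧ a.Monic ∧ b.Monic ∧ IsCoprime a b ∧
      f = h * a ∧ g = h * b := by
  classical
  have hd : EuclideanDomain.gcd f g ≠ 0 := fun h0 =>
    hf.ne_zero (EuclideanDomain.gcd_eq_zero_iff.1 h0).1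
  obtain ⟨a, ha⟩ : normalize (EuclideanDomain.gcd f g) ∣ f :=
    normalize_dvd_iff.2 (EuclideanDomain.gcd_dvd_left f g)
  obtain ⟨b, hb⟩ : normalize (EuclideanDomain.gcd f g) ∣ g :=
    normalize_dvd_iff.2 (EuclideanDomain.gcd_dvd_right f g)
  have hh := monic_normalize hd
  refine ⟨_, a, b, hh, hh.of_mul_monic_left (ha ▸ hf), hh.of_mul_monic_left (hb ▸ hg),
    ?_, ha, hb⟩
  obtain ⟨c, hc⟩ : EuclideanDomain.gcd f g ∣ normalize (EuclideanDomain.gcd f g) :=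
    dvd_normalize_iff.2 dvd_rfl
  have hbez := EuclideanDomain.gcd_eq_gcd_ab f g
  refine ⟨c * EuclideanDomain.gcdA f g, c * EuclideanDomain.gcdB f g,
    mul_left_cancel₀ hh.ne_zero ?_⟩
  generalize normalize (EuclideanDomain.gcd f g) = h at *
  generalize EuclideanDomain.gcd f g = d at *
  linear_combination -hc - c * hbez - c * EuclideanDomain.gcdA f g * ha
    - c * EuclideanDomain.gcdB f g * hb

theorem card_gcdTriples (F : Type*) [Field F] [Fintype F] (m n : ℕ) :
    Nat.card (gcdTriples F m n) = Fintype.card F ^ (m + n) := by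
  rw [pow_add, ← card_monic_natDegree_eq F m, ← card_monic_natDegree_eq F n, ← Nat.card_prod]
  let φ : gcdTriples F m n → {p : F[X] // p.Monic ∧ p.natDegree = m} ×
      {p : F[X] // p.Monic ∧ p.natDegree = n} := fun t =>
    (⟨t.1.1 * t.1.2.1, t.2.1.mul t.2.2.1, (t.2.1.natDegree_mul t.2.2.1).trans t.2.2.2.2.1⟩,
     ⟨t.1.1 * t.1.2.2, t.2.1.mul t.2.2.2.1,
      (t.2.1.natDegree_mul t.2.2.2.1).trans t.2.2.2.2.2.1⟩)
  refine Nat.card_eq_of_bijective φ ⟨?_, ?_⟩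
  · rintro ⟨⟨h, a, b⟩, hh, ha, hb, hm, hn, hab⟩ ⟨⟨k, c, d⟩, hk, hc, hd, hm', hn', hcd⟩ heq
    simp only [φ, Prod.mk.injEq, Subtype.mk.injEq] at heq
    obtain ⟨h₁, h₂⟩ := heq
    have hhk : h = k := eq_of_monic_of_associated hh hk (associated_of_dvd_dvd
      (dvd_of_mul_eq_mul_of_isCoprime hcd h₁.symm h₂.symm)
      (dvd_of_mul_eq_mul_of_isCoprime hab h₁ h₂))
    subst hhk
    have h₃ := mul_left_cancel₀ hh.ne_zero h₁
    have h₄ := mul_left_cancel₀ hh.ne_zero h₂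
    subst h₃ h₄
    rfl
  · rintro ⟨⟨f, hf, hfm⟩, ⟨g, hg, hgn⟩⟩
    obtain ⟨h, a, b, hh, ha, hb, hab, rfl, rfl⟩ := exists_monic_mul_isCoprime hf hg
    exact ⟨⟨(h, a, b), hh, ha, hb, (hh.natDegree_mul ha).symm.trans hfm,
      (hh.natDegree_mul hb).symm.trans hgn, hab⟩, rfl⟩

theorem Polynomial.Monic.mul_X_add_C {R : Type*} [CommRing R] [Nontrivial R]
    {p : R[X]} (hp : p.Monic) (c : R) :
    (p * X + C c).Monic ∧ (p * X + C c).natDegree = p.natDegree + 1 := by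
  have h : (p * X).natDegree = p.natDegree + 1 := natDegree_mul_X hp.ne_zero
  refine ⟨(hp.mul monic_X).add_of_left ?_, by rw [natDegree_add_C, h]⟩
  refine degree_C_le.trans_lt (natDegree_pos_iff_degree_pos.1 ?_)
  omega

theorem card_gcdTriples_natDegree_pos (F : Type*) [Field F] [Fintype F] (m n : ℕ) :
    Nat.card {t : gcdTriples F (m + 1) (n + 1) // t.1.1.natDegree ≠ 0} =
      Fintype.card F * Nat.card (gcdTriples F m n) := by
  rw [← Nat.card_eq_fintype_card, ← Nat.card_prod]
  let φ : F × gcdTriples F m n →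
      {t : gcdTriples F (m + 1) (n + 1) // t.1.1.natDegree ≠ 0} := fun x =>
    have hx := x.2.2.1.mul_X_add_C x.1
    ⟨⟨(x.2.1.1 * X + C x.1, x.2.1.2), hx.1, x.2.2.2.1, x.2.2.2.2.1,
      by have := x.2.2.2.2.2.1; have := hx.2; dsimp only; omega,
      by have := x.2.2.2.2.2.2.1; have := hx.2; dsimp only; omega, x.2.2.2.2.2.2.2⟩,
      by have := hx.2; dsimp only; omega⟩
  refine (Nat.card_eq_of_bijective φ ⟨?_, ?_⟩).symm
  · rintro ⟨c, ⟨⟨h, a⟩, hh⟩⟩ ⟨d, ⟨⟨k, b⟩, hk⟩⟩ heq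
    have h₁ : h * X + C c = k * X + C d := congrArg (fun t => t.1.1.1) heq
    have h₂ : a = b := congrArg (fun t => t.1.1.2) heq
    subst h₂
    have hcd : c = d := by simpa using congrArg (fun p => p.coeff 0) h₁
    subst hcd
    have hhk : h = k := mul_right_cancel₀ X_ne_zero (add_right_cancel h₁)
    subst hhk
    rfl
  · rintro ⟨⟨⟨h, a, b⟩, hh, ha, hb, hm, hn, hab⟩, h0⟩
    dsimp only at hh ha hb hm hn hab h0
    have hdeg : h.divX.natDegree + 1 = h.natDegree := by
      rw [natDegree_divX_eq_natDegree_tsub_one]; omega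
    have hmon : h.divX.Monic := by
      rw [Monic, leadingCoeff, coeff_divX, hdeg]; exact hh
    refine ⟨(h.coeff 0, ⟨(h.divX, a, b), hmon, ha, hb, ?_, ?_, hab⟩), ?_⟩
    · dsimp only; omega
    · dsimp only; omega
    · simp only [φ, divX_mul_X_add]

theorem card_gcdTriples_natDegree_eq_zero (F : Type*) [Field F] (m n : ℕ) :
    Nat.card {t : gcdTriples F m n // t.1.1.natDegree = 0} =
      Nat.card {P : F[X] × F[X] // P.1.Monic ∧ P.2.Monic ∧ P.1.natDegree = m ∧
        P.2.natDegree = n ∧ IsCoprime P.1 P.2} := by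
  refine Nat.card_congr
    { toFun := fun t => ⟨t.1.1.2, t.1.2.2.1, t.1.2.2.2.1, ?_, ?_, t.1.2.2.2.2.2.2⟩
      invFun := fun P => ⟨⟨(1, P.1), monic_one, P.2.1, P.2.2.1, ?_, ?_, P.2.2.2.2.2⟩,
        natDegree_one⟩
      left_inv := ?_
      right_inv := fun _ => rfl }
  · have := t.1.2.2.2.2.1; have := t.2; omega
  · have := t.1.2.2.2.2.2.1; have := t.2; omega
  · simpa using P.2.2.2.1
  · simpa using P.2.2.2.2.1
  · rintro ⟨⟨⟨h, a⟩, hh⟩, h0⟩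
    have h1 : h = 1 := hh.1.natDegree_eq_zero.1 h0
    subst h1
    rfl

theorem card_coprime_monic_pairs_add (F : Type*) [Field F] [Fintype F] (m n : ℕ) :
    Nat.card {P : F[X] × F[X] // P.1.Monic ∧ P.2.Monic ∧ P.1.natDegree = m + 1 ∧
        P.2.natDegree = n + 1 ∧ IsCoprime P.1 P.2} + Fintype.card F ^ (m + n + 1) =
      Fintype.card F ^ (m + n + 2) := by
  have hfin : Finite (gcdTriples F (m + 1) (n + 1)) := Nat.finite_of_card_ne_zero (by
    rw [card_gcdTriples]; exact pow_ne_zero _ Fintype.card_ne_zero)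
  classical
  have h := Nat.card_congr (Equiv.sumCompl
    fun t : gcdTriples F (m + 1) (n + 1) => t.1.1.natDegree = 0)
  rw [Nat.card_sum, card_gcdTriples_natDegree_eq_zero, card_gcdTriples_natDegree_pos,
    card_gcdTriples, card_gcdTriples] at h
  rw [pow_succ', h]
  congr 1
  omega

/-- Lemma A1 (first part): the number `α_{m,n}` of ordered pairs of coprime monic
polynomials over `F_q` of degrees `m` and `n`. -/
theorem count_coprime_monic_pairs (q m n : ℕ) (hq : IsPrimePow q)
    (F : Type*) [Field F] [Fintype F] (hF : Fintype.card F = q) :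
    (m = 0 →
      Nat.card {P : Polynomial F × Polynomial F //
          P.1.Monic ∧ P.2.Monic ∧ P.1.natDegree = m ∧ P.2.natDegree = n ∧
          IsCoprime P.1 P.2} = q ^ n) ∧
    (0 < m → 0 < n →
      (Nat.card {P : Polynomial F × Polynomial F //
          P.1.Monic ∧ P.2.Monic ∧ P.1.natDegree = m ∧ P.2.natDegree = n ∧
          IsCoprime P.1 P.2} : ℚ) = (q : ℚ) ^ (m + n) * (1 - (q : ℚ)⁻¹)) := by
  constructor
  · rintro rfl
    rw [← hF, ← card_monic_natDegree_eq F n]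
    refine Nat.card_congr
      { toFun := fun P => ⟨P.1.2, P.2.2.1, P.2.2.2.2.1⟩
        invFun := fun p => ⟨(1, p.1), monic_one, p.2.1, natDegree_one, p.2.2,
          isCoprime_one_left⟩
        left_inv := ?_
        right_inv := fun _ => rfl }
    rintro ⟨⟨f, g⟩, hf, hg, h0, hn, hfg⟩
    have h1 : f = 1 := hf.natDegree_eq_zero.1 h0
    subst h1
    rfl
  · intro hm hn
    obtain ⟨m, rfl⟩ := Nat.exists_eq_add_one.2 hm
    obtain ⟨n, rfl⟩ := Nat.exists_eq_add_one.2 hn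
    have h := card_coprime_monic_pairs_add F m n
    rw [hF] at h
    have hq0 : (q : ℚ) ≠ 0 := Nat.cast_ne_zero.2 hq.ne_zero
    rw [eq_sub_of_add_eq (by exact_mod_cast h :
      (Nat.card {P : F[X] × F[X] // P.1.Monic ∧ P.2.Monic ∧ P.1.natDegree = m + 1 ∧
        P.2.natDegree = n + 1 ∧ IsCoprime P.1 P.2} : ℚ) + (q : ℚ) ^ (m + n + 1) =
          (q : ℚ) ^ (m + n + 2))]
    field_simp
    ring
end

section
/- Let q be a prime power and m, n ≥ 0, and let β_{m,n} be the number of ordered pairs (f, g) with f, g ∈ F_q[X] monic, deg f = m, deg g = n, f(0) ≠ 0, and gcd(f, g) = 1. Then β_{m,n} = q^{m-n-1}(q-1)(q^{2n+1}+1)/(q+1) if m > n ≥ 0; β_{m,n} = q^n if m = 0; and β_{m,n} = q^{n-m}(q-1)(q^{2m}-1)/(q+1) if 1 ≤ m ≤ n. -/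
open Polynomial

open Finset in
/-- The recurrence satisfied by sums `∑ u k * b l` over antidiagonals when `u 0 = 1`,
`u 1 = q - 1` and `u (k + 2) = q * u (k + 1)`. -/
theorem sum_antidiagonal_sub_mul_sum_antidiagonal {R : Type*} [CommRing R] (q : R) (u b : ℕ → R)
    (h0 : u 0 = 1) (h1 : u 1 = q - 1) (hu : ∀ k, u (k + 2) = q * u (k + 1)) (N : ℕ) :
    ∑ p ∈ antidiagonal (N + 1), u p.1 * b p.2 - q * ∑ p ∈ antidiagonal N, u p.1 * b p.2 =
      b (N + 1) - b N := by
  cases N with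
  | zero => simp [Nat.sum_antidiagonal_succ, h0, h1]; ring
  | succ N =>
    simp only [Nat.sum_antidiagonal_succ, h0, h1, hu, mul_assoc, ← Finset.mul_sum, zero_add]
    ring

namespace Polynomial

theorem exists_monic_mul_isCoprime {F : Type*} [Field F] {f g : F[X]} (hf : f.Monic) (hg : g.Monic) :
    ∃ d a b : F[X], d.Monic ∧ a.Monic ∧ b.Monic ∧ IsCoprime a b ∧ f = d * a ∧ g = d * b := by
  classical
  have h0 : EuclideanDomain.gcd f g ≠ 0 := fun h =>
    hf.ne_zero (EuclideanDomain.gcd_eq_zero_iff.mp h).1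
  set c := EuclideanDomain.gcd f g with hc
  have hd : (c * C c.leadingCoeff⁻¹).Monic := monic_mul_leadingCoeff_inv h0
  have hu : IsUnit (C c.leadingCoeff⁻¹) := by simpa using h0
  obtain ⟨a, ha⟩ : c * C c.leadingCoeff⁻¹ ∣ f :=
    hu.mul_right_dvd.mpr (EuclideanDomain.gcd_dvd_left f g)
  obtain ⟨b, hb⟩ : c * C c.leadingCoeff⁻¹ ∣ g :=
    hu.mul_right_dvd.mpr (EuclideanDomain.gcd_dvd_right f g)
  refine ⟨_, a, b, hd, hd.of_mul_monic_left (ha ▸ hf), hd.of_mul_monic_left (hb ▸ hg), ?_, ha, hb⟩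
  have hbez := EuclideanDomain.gcd_eq_gcd_ab f g
  rw [← hc] at hbez
  refine ⟨C c.leadingCoeff⁻¹ * EuclideanDomain.gcdA f g,
    C c.leadingCoeff⁻¹ * EuclideanDomain.gcdB f g, mul_left_cancel₀ h0 ?_⟩
  generalize EuclideanDomain.gcdA f g = x at *
  generalize EuclideanDomain.gcdB f g = y at *
  calc _ = (c * C c.leadingCoeff⁻¹ * a) * x + (c * C c.leadingCoeff⁻¹ * b) * y := by ring
    _ = c * 1 := by rw [← ha, ← hb, mul_one, hbez]

theorem dvd_of_mul_eq_mul_of_isCoprime {F : Type*} [Field F] {d a b d' a' b' : F[X]}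
    (h : IsCoprime a b) (ha : d * a = d' * a') (hb : d * b = d' * b') : d' ∣ d := by
  obtain ⟨x, y, hxy⟩ := h
  refine ⟨x * a' + y * b', ?_⟩
  linear_combination (-d) * hxy + x * ha + y * hb

variable (F : Type*) [Field F] [Fintype F]

theorem card_monic_natDegree_eq (n : ℕ) :
    Nat.card {p : F[X] // p.Monic ∧ p.natDegree = n} = Fintype.card F ^ n := by
  rw [Nat.card_congr ((monicEquivDegreeLT n).trans (degreeLTEquiv F n).toEquiv)]
  simp

theorem finite_monic_natDegree_eq (n : ℕ) : {p : F[X] | p.Monic ∧ p.natDegree = n}.Finite :=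
  Set.finite_coe_iff.mp <| Finite.of_equiv _
     ((monicEquivDegreeLT n).trans (degreeLTEquiv F n).toEquiv).symm

/-- The monic polynomials of degree `n` over a finite field. -/
noncomputable def monicFinset (n : ℕ) : Finset F[X] := (finite_monic_natDegree_eq F n).toFinset

open Classical in
/-- The monic polynomials of degree `n` over a finite field with nonzero constant term. -/
noncomputable def monicNonzeroConstFinset (n : ℕ) : Finset F[X] :=
  (monicFinset F n).filter fun p => p.eval 0 ≠ 0

open Classical in
/-- The pairs of coprime monic polynomials of degrees `m` and `n`, the first with nonzero
constant term. -/
noncomputable def coprimePairFinset (m n : ℕ) : Finset (F[X] × F[X]) :=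
  (monicNonzeroConstFinset F m ×ˢ monicFinset F n).filter fun P => IsCoprime P.1 P.2

variable {F}

theorem mem_monicFinset {n : ℕ} {p : F[X]} :
    p ∈ monicFinset F n ↔ p.Monic ∧ p.natDegree = n := by
  simp [monicFinset]

theorem mem_monicNonzeroConstFinset {n : ℕ} {p : F[X]} :
    p ∈ monicNonzeroConstFinset F n ↔ (p.Monic ∧ p.natDegree = n) ∧ p.eval 0 ≠ 0 := by
  simp [monicNonzeroConstFinset, mem_monicFinset]

theorem mem_coprimePairFinset {m n : ℕ} {P : F[X] × F[X]} :
    P ∈ coprimePairFinset F m n ↔ (((P.1.Monic ∧ P.1.natDegree = m) ∧ P.1.eval 0 ≠ 0) ∧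
      P.2.Monic ∧ P.2.natDegree = n) ∧ IsCoprime P.1 P.2 := by
  simp [coprimePairFinset, mem_monicFinset, mem_monicNonzeroConstFinset]

variable (F)

theorem card_monicFinset (n : ℕ) : (monicFinset F n).card = Fintype.card F ^ n := by
  rw [← card_monic_natDegree_eq]
  exact (Nat.subtype_card _ fun _ => mem_monicFinset).symm

theorem monicNonzeroConstFinset_zero : monicNonzeroConstFinset F 0 = {1} := by
  ext p
  rw [mem_monicNonzeroConstFinset, Finset.mem_singleton]
  constructor
  · rintro ⟨⟨h, h'⟩, -⟩
    exact h.natDegree_eq_zero.mp h'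
  · rintro rfl
    simp

theorem card_monicNonzeroConstFinset_succ (n : ℕ) :
    (monicNonzeroConstFinset F (n + 1)).card + Fintype.card F ^ n = Fintype.card F ^ (n + 1) := by
  classical
  rw [← card_monicFinset, ← card_monicFinset,
    ← Finset.card_filter_add_card_filter_not (s := monicFinset F (n + 1)) (fun p => p.eval 0 ≠ 0)]
  congr 1
  refine Finset.card_bij (fun p _ => X * p) ?_ ?_ ?_
  · intro p hp
    rw [mem_monicFinset] at hp
    simp only [Finset.mem_filter, mem_monicFinset]
    refine ⟨⟨monic_X.mul hp.1, ?_⟩, by simp⟩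
    rw [monic_X.natDegree_mul hp.1, natDegree_X, hp.2, add_comm]
  · intro p _ r _ h
    exact mul_left_cancel₀ X_ne_zero h
  · intro p hp
    simp only [Finset.mem_filter, mem_monicFinset, not_not] at hp
    obtain ⟨⟨hm, hd⟩, h0⟩ := hp
    obtain ⟨r, rfl⟩ : X ∣ p := X_dvd_iff.mpr (by rwa [coeff_zero_eq_eval_zero])
    have hr : r.Monic := monic_X.of_mul_monic_left hm
    refine ⟨r, mem_monicFinset.mpr ⟨hr, ?_⟩, rfl⟩
    rw [monic_X.natDegree_mul hr, natDegree_X] at hd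
    omega

open Finset in
theorem sum_antidiagonal_card_coprimePairFinset (a b N : ℕ) (hab : a = 0 ∨ b = 0) :
    ∑ p ∈ antidiagonal N, (monicNonzeroConstFinset F p.1).card *
        (coprimePairFinset F (a + p.2) (b + p.2)).card =
      (monicNonzeroConstFinset F (a + N)).card * Fintype.card F ^ (b + N) := by
  classical
  rw [← card_monicFinset, ← card_product]
  simp_rw [← card_product]
  rw [← card_biUnion]
  · refine card_bij (fun t _ => (t.1 * t.2.1, t.1 * t.2.2)) ?_ ?_ ?_
    · rintro ⟨d, f, g⟩ h
      simp only [mem_biUnion, HasAntidiagonal.mem_antidiagonal, mem_product,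
        mem_monicNonzeroConstFinset, mem_coprimePairFinset, mem_monicFinset] at h ⊢
      obtain ⟨⟨k, l⟩, hkl, ⟨⟨hd, hdk⟩, hd0⟩, ⟨⟨⟨hf, hfl⟩, hf0⟩, hg, hgl⟩, -⟩ := h
      dsimp only at *
      refine ⟨⟨⟨hd.mul hf, ?_⟩, ?_⟩, hd.mul hg, ?_⟩
      · rw [hd.natDegree_mul hf]; omega
      · rw [eval_mul]; exact mul_ne_zero hd0 hf0
      · rw [hd.natDegree_mul hg]; omega
    · rintro ⟨d, f, g⟩ h ⟨d', f', g'⟩ h' heq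
      simp only [mem_biUnion, mem_product, mem_monicNonzeroConstFinset,
        mem_coprimePairFinset] at h h'
      obtain ⟨-, -, ⟨⟨hd, -⟩, -⟩, -, hco⟩ := h
      obtain ⟨-, -, ⟨⟨hd', -⟩, -⟩, -, hco'⟩ := h'
      simp only [Prod.mk.injEq] at heq
      obtain ⟨h1, h2⟩ := heq
      obtain rfl : d = d' := eq_of_monic_of_associated hd hd' <| associated_of_dvd_dvd
        (dvd_of_mul_eq_mul_of_isCoprime hco' h1.symm h2.symm)
        (dvd_of_mul_eq_mul_of_isCoprime hco h1 h2)
      rw [mul_left_cancel₀ hd.ne_zero h1, mul_left_cancel₀ hd.ne_zero h2]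
    · rintro ⟨f, g⟩ h
      simp only [mem_product, mem_monicNonzeroConstFinset, mem_monicFinset] at h
      obtain ⟨⟨⟨hf, hfd⟩, hf0⟩, hg, hgd⟩ := h
      obtain ⟨d, f', g', hd, hf', hg', hco, rfl, rfl⟩ := exists_monic_mul_isCoprime hf hg
      rw [hd.natDegree_mul hf'] at hfd
      rw [hd.natDegree_mul hg'] at hgd
      rw [eval_mul] at hf0
      refine ⟨(d, f', g'), ?_, rfl⟩
      simp only [mem_biUnion, HasAntidiagonal.mem_antidiagonal, mem_product,
        mem_monicNonzeroConstFinset, mem_coprimePairFinset]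
      exact ⟨(d.natDegree, N - d.natDegree), by omega,
        ⟨⟨hd, rfl⟩, left_ne_zero_of_mul hf0⟩,
        ⟨⟨⟨hf', by dsimp only; omega⟩, right_ne_zero_of_mul hf0⟩, hg', by dsimp only; omega⟩, hco⟩
  · rintro ⟨k, l⟩ hkl ⟨k', l'⟩ hkl' hne
    refine disjoint_left.mpr ?_
    rintro ⟨d, P⟩ h h'
    simp only [mem_product, mem_monicNonzeroConstFinset] at h h'
    simp only [mem_coe, HasAntidiagonal.mem_antidiagonal] at hkl hkl'
    obtain ⟨⟨⟨-, h1⟩, -⟩, -⟩ := h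
    obtain ⟨⟨⟨-, h2⟩, -⟩, -⟩ := h'
    apply hne
    ext <;> dsimp only <;> omega

theorem cast_card_monicNonzeroConstFinset_succ (n : ℕ) :
    ((monicNonzeroConstFinset F (n + 1)).card : ℚ) =
      ((Fintype.card F : ℚ) - 1) * (Fintype.card F : ℚ) ^ n := by
  have h := congrArg (Nat.cast : ℕ → ℚ) (card_monicNonzeroConstFinset_succ F n)
  push_cast at h
  linear_combination h

theorem card_coprimePairFinset_zero_left (n : ℕ) :
    (coprimePairFinset F 0 n).card = Fintype.card F ^ n := by
  simpa [monicNonzeroConstFinset_zero] using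
    sum_antidiagonal_card_coprimePairFinset F 0 n 0 (.inl rfl)

theorem card_coprimePairFinset_zero_right (m : ℕ) :
    (coprimePairFinset F m 0).card = (monicNonzeroConstFinset F m).card := by
  simpa [monicNonzeroConstFinset_zero] using
    sum_antidiagonal_card_coprimePairFinset F m 0 0 (.inr rfl)

theorem card_coprimePairFinset_succ_succ (m n : ℕ) :
    ((coprimePairFinset F (m + 1) (n + 1)).card : ℚ) = (coprimePairFinset F m n).card +
      ((monicNonzeroConstFinset F (m + 1)).card * (Fintype.card F : ℚ) ^ (n + 1) -
        Fintype.card F * ((monicNonzeroConstFinset F m).card * (Fintype.card F : ℚ) ^ n)) := by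
  obtain ⟨a, b, N, hab, rfl, rfl⟩ :
      ∃ a b N, (a = 0 ∨ b = 0) ∧ m = a + N ∧ n = b + N :=
    ⟨m - min m n, n - min m n, min m n, by omega, by omega, by omega⟩
  have h := sum_antidiagonal_sub_mul_sum_antidiagonal (Fintype.card F : ℚ)
    (fun k => ((monicNonzeroConstFinset F k).card : ℚ))
    (fun l => ((coprimePairFinset F (a + l) (b + l)).card : ℚ))
    (by simp [monicNonzeroConstFinset_zero])
    (by simpa using cast_card_monicNonzeroConstFinset_succ F 0)
    (fun k => by simp only [cast_card_monicNonzeroConstFinset_succ]; ring) N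
  have h1 := congrArg (Nat.cast : ℕ → ℚ)
    (sum_antidiagonal_card_coprimePairFinset F a b (N + 1) hab)
  have h2 := congrArg (Nat.cast : ℕ → ℚ) (sum_antidiagonal_card_coprimePairFinset F a b N hab)
  push_cast at h1 h2
  rw [h1, h2] at h
  simp only [← add_assoc] at h
  linear_combination -h

theorem card_coprimePairFinset_of_lt (k n : ℕ) :
    ((coprimePairFinset F (n + k + 1) n).card : ℚ) * ((Fintype.card F : ℚ) + 1) =
      (Fintype.card F : ℚ) ^ k * ((Fintype.card F : ℚ) - 1) *
        ((Fintype.card F : ℚ) ^ (2 * n + 1) + 1) := by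
  induction n with
  | zero =>
    rw [card_coprimePairFinset_zero_right, zero_add, cast_card_monicNonzeroConstFinset_succ]
    ring
  | succ n ih =>
    rw [show n + 1 + k + 1 = n + k + 1 + 1 by ring, card_coprimePairFinset_succ_succ, add_mul, ih]
    simp only [cast_card_monicNonzeroConstFinset_succ]
    ring

theorem card_coprimePairFinset_of_le (k m : ℕ) :
    ((coprimePairFinset F (m + 1) (m + 1 + k)).card : ℚ) * ((Fintype.card F : ℚ) + 1) =
      (Fintype.card F : ℚ) ^ k * ((Fintype.card F : ℚ) - 1) *
        ((Fintype.card F : ℚ) ^ (2 * (m + 1)) - 1) := by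
  induction m with
  | zero =>
    rw [show 0 + 1 + k = k + 1 by ring, card_coprimePairFinset_succ_succ,
      card_coprimePairFinset_zero_left, cast_card_monicNonzeroConstFinset_succ,
      monicNonzeroConstFinset_zero]
    push_cast
    simp
    ring
  | succ m ih =>
    rw [show m + 1 + 1 + k = m + 1 + k + 1 by ring, card_coprimePairFinset_succ_succ, add_mul, ih]
    simp only [cast_card_monicNonzeroConstFinset_succ]
    ring

theorem card_coprime_monic_pairs (m n : ℕ) :
    Nat.card {P : F[X] × F[X] // P.1.Monic ∧ P.2.Monic ∧ P.1.natDegree = m ∧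
      P.2.natDegree = n ∧ P.1.eval 0 ≠ 0 ∧ IsCoprime P.1 P.2} =
      (coprimePairFinset F m n).card := by
  refine Nat.subtype_card _ fun P => ?_
  rw [mem_coprimePairFinset]
  tauto

end Polynomial

/-- Lemma A3: the number `β_{m,n}` of ordered pairs `(f, g)` of coprime monic
polynomials over `F_q` with `deg f = m`, `deg g = n` and `f(0) ≠ 0`. -/
theorem count_coprime_monic_pairs_nonzero_const (q m n : ℕ) (hq : IsPrimePow q)
    (F : Type*) [Field F] [Fintype F] (hF : Fintype.card F = q) :
    (n < m →
      (Nat.card {P : Polynomial F × Polynomial F //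
          P.1.Monic ∧ P.2.Monic ∧ P.1.natDegree = m ∧ P.2.natDegree = n ∧
          P.1.eval 0 ≠ 0 ∧ IsCoprime P.1 P.2} : ℚ) =
        (q : ℚ) ^ (m - n - 1) * ((q : ℚ) - 1) * ((q : ℚ) ^ (2 * n + 1) + 1) /
          ((q : ℚ) + 1)) ∧
    (m = 0 →
      Nat.card {P : Polynomial F × Polynomial F //
          P.1.Monic ∧ P.2.Monic ∧ P.1.natDegree = m ∧ P.2.natDegree = n ∧
          P.1.eval 0 ≠ 0 ∧ IsCoprime P.1 P.2} = q ^ n) ∧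
    (1 ≤ m → m ≤ n →
      (Nat.card {P : Polynomial F × Polynomial F //
          P.1.Monic ∧ P.2.Monic ∧ P.1.natDegree = m ∧ P.2.natDegree = n ∧
          P.1.eval 0 ≠ 0 ∧ IsCoprime P.1 P.2} : ℚ) =
        (q : ℚ) ^ (n - m) * ((q : ℚ) - 1) * ((q : ℚ) ^ (2 * m) - 1) /
          ((q : ℚ) + 1)) := by
  have hq1 : (Fintype.card F : ℚ) + 1 ≠ 0 := by positivity
  subst hF
  simp only [Polynomial.card_coprime_monic_pairs]
  refine ⟨fun h => ?_, ?_, fun h1 h => ?_⟩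
  · obtain ⟨k, rfl⟩ := Nat.exists_eq_add_of_lt h
    rw [eq_div_iff hq1, Polynomial.card_coprimePairFinset_of_lt,
      show n + k + 1 - n - 1 = k by omega]
  · rintro rfl
    exact Polynomial.card_coprimePairFinset_zero_left F n
  · obtain ⟨k, rfl⟩ := Nat.exists_eq_add_of_le h
    obtain ⟨m, rfl⟩ := Nat.exists_eq_add_of_le' h1
    rw [eq_div_iff hq1, Polynomial.card_coprimePairFinset_of_le, Nat.add_sub_cancel_left]
end

section
/- Let q be a prime power and i ≥ 0. The number Λ_i of monic self-dual polynomials of degree i in F_{q^2}[X] equals 1 if i = 0, and equals (q+1)·q^{i-1} if i > 0. -/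
open Polynomial

/-- For `g ∈ F_{q^2}[X]`, `dualPoly q g = X^(deg g) · ḡ(1/X)`, where `ḡ` is
obtained from `g` by applying the Frobenius `x ↦ x^q` to the coefficients:
the coefficients of `g` are reversed and raised to the `q`-th power. -/
noncomputable def dualPoly {E : Type*} [Field E] (q : ℕ) (g : Polynomial E) :
    Polynomial E :=
  ∑ i ∈ Finset.range (g.natDegree + 1),
    Polynomial.C (g.coeff i ^ q) * Polynomial.X ^ (g.natDegree - i)

/-- A nonzero polynomial `g ∈ F_{q^2}[X]` is self-dual if `g̃ = c·g` for some
`c ∈ F_{q^2}^*`. -/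
def IsSelfDual {E : Type*} [Field E] (q : ℕ) (g : Polynomial E) : Prop :=
  ∃ c : E, c ≠ 0 ∧ dualPoly q g = Polynomial.C c * g

lemma dualPoly_coeff {E : Type*} [Field E] (q : ℕ) (g : E[X]) {m : ℕ} (hm : m ≤ g.natDegree) :
    (dualPoly q g).coeff m = g.coeff (g.natDegree - m) ^ q := by
  rw [dualPoly, finsetSum_coeff, Finset.sum_eq_single (g.natDegree - m)]
  · rw [coeff_C_mul_X_pow, if_pos (Nat.sub_sub_self hm).symm]
  · intro b hb hne
    rw [coeff_C_mul_X_pow, if_neg]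
    rw [Finset.mem_range] at hb
    omega
  · intro h
    simp at h

lemma dualPoly_coeff_eq_zero {E : Type*} [Field E] (q : ℕ) (g : E[X]) {m : ℕ}
    (hm : g.natDegree < m) : (dualPoly q g).coeff m = 0 := by
  rw [dualPoly, finsetSum_coeff]
  refine Finset.sum_eq_zero fun b _ => ?_
  rw [coeff_C_mul_X_pow, if_neg (by omega)]

lemma isSelfDual_iff_coeff {E : Type*} [Field E] (q : ℕ) {g : E[X]} (hg : g.Monic) :
    IsSelfDual q g ↔
      ∀ j ≤ g.natDegree, g.coeff 0 * g.coeff (g.natDegree - j) ^ q = g.coeff j := by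
  have hlead : g.coeff g.natDegree = 1 := hg
  constructor
  · rintro ⟨c, -, hc⟩ j hj
    have h0 : 1 = c * g.coeff 0 := by
      simpa [dualPoly_coeff q g (Nat.zero_le _), hlead] using congrArg (coeff · 0) hc
    have h : g.coeff (g.natDegree - j) ^ q = c * g.coeff j := by
      simpa [dualPoly_coeff q g hj] using congrArg (coeff · j) hc
    rw [h]
    linear_combination -g.coeff j * h0
  · intro h
    have h0 : g.coeff 0 ≠ 0 := by
      intro h0
      simpa [h0, hlead] using h _ le_rfl
    refine ⟨(g.coeff 0)⁻¹, inv_ne_zero h0, ?_⟩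
    ext m
    rw [coeff_C_mul]
    rcases le_or_gt m g.natDegree with hm | hm
    · rw [dualPoly_coeff q g hm, ← h m hm, inv_mul_cancel_left₀ h0]
    · rw [dualPoly_coeff_eq_zero q g hm, coeff_eq_zero_of_natDegree_lt hm, mul_zero]

lemma isSelfDual_iff_coeff_succ {E : Type*} [Field E] (q : ℕ) {g : E[X]} (hg : g.Monic) {k : ℕ}
    (hk : g.natDegree = k + 1) :
    IsSelfDual q g ↔ g.coeff 0 ^ (q + 1) = 1 ∧
      ∀ j : Fin k, g.coeff 0 * g.coeff ((Fin.rev j : ℕ) + 1) ^ q = g.coeff (j + 1) := by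
  have hlead : g.coeff (k + 1) = 1 := hk ▸ hg
  rw [isSelfDual_iff_coeff q hg, hk]
  constructor
  · intro h
    refine ⟨?_, fun j => ?_⟩
    · simpa [pow_succ', hlead] using h _ le_rfl
    · have hj : (Fin.rev j : ℕ) + 1 = k + 1 - (j + 1) := by
        rw [Fin.val_rev]
        omega
      rw [hj, h _ (by omega)]
  · rintro ⟨h0, h⟩ j hj
    rcases j with _ | j
    · simp [hlead]
    · rcases eq_or_lt_of_le (Nat.le_of_succ_le_succ hj) with rfl | hjk
      · rw [Nat.sub_self, ← pow_succ', h0, hlead]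
      · rw [← h ⟨j, hjk⟩]
        congr 3
        rw [Fin.val_rev]
        dsimp only
        omega

/-- A monic polynomial of degree `n` is determined by its lower coefficients. -/
noncomputable def monicEquivFun (E : Type*) [Field E] (n : ℕ) :
    {g : E[X] // g.Monic ∧ g.natDegree = n} ≃ (Fin n → E) :=
  (monicEquivDegreeLT n).trans (degreeLTEquiv E n).toEquiv

lemma monicEquivFun_apply {E : Type*} [Field E] {n : ℕ}
    (g : {g : E[X] // g.Monic ∧ g.natDegree = n}) (j : Fin n) :
    monicEquivFun E n g j = g.1.coeff j := by
  simp only [monicEquivFun, monicEquivDegreeLT, degreeLTEquiv]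
  simp only [Equiv.trans_apply, Equiv.coe_fn_mk, LinearEquiv.coe_toEquiv]
  change g.1.eraseLead.coeff j = _
  exact eraseLead_coeff_of_ne _ (by rw [g.2.2]; exact j.2.ne)

/-- A monic self-dual polynomial of degree `k + 1` amounts to its constant coefficient `u`, which
satisfies `u ^ (q + 1) = 1`, and its `k` middle coefficients, which are fixed by
`f ↦ u * (f ∘ rev) ^ q`. -/
noncomputable def selfDualEquiv (E : Type*) [Field E] (q k : ℕ) :
    {g : E[X] // g.Monic ∧ g.natDegree = k + 1 ∧ IsSelfDual q g} ≃
      Σ u : {u : E // u ^ (q + 1) = 1},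
        {f : Fin k → E // ∀ j, u.1 * f (Fin.rev j) ^ q = f j} :=
  calc
    {g : E[X] // g.Monic ∧ g.natDegree = k + 1 ∧ IsSelfDual q g}
      ≃ {g : E[X] // (g.Monic ∧ g.natDegree = k + 1) ∧ IsSelfDual q g} :=
        Equiv.subtypeEquivRight fun _ => and_assoc.symm
    _ ≃ {g : {g : E[X] // g.Monic ∧ g.natDegree = k + 1} // IsSelfDual q g.1} :=
        (Equiv.subtypeSubtypeEquivSubtypeInter _ _).symm
    _ ≃ {v : Fin (k + 1) → E //
          v 0 ^ (q + 1) = 1 ∧ ∀ j : Fin k, v 0 * v (Fin.rev j).succ ^ q = v j.succ} :=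
        (monicEquivFun E (k + 1)).subtypeEquiv fun g => by
          simpa only [monicEquivFun_apply, Fin.val_zero, Fin.val_succ] using
            isSelfDual_iff_coeff_succ q g.2.1 g.2.2
    _ ≃ _ :=
      { toFun := fun v => ⟨⟨v.1 0, v.2.1⟩, ⟨fun j => v.1 j.succ, v.2.2⟩⟩
        invFun := fun w => ⟨Fin.cons w.1.1 w.2.1, by simpa using w.1.2, by simpa using w.2.2⟩
        left_inv := fun v => Subtype.ext (Fin.cons_self_tail v.1)
        right_inv := fun _ => rfl }

lemma card_pow_succ_eq_one {q : ℕ} {E : Type*} [Field E] [Fintype E]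
    (hE : Fintype.card E = q ^ 2) : Nat.card {u : E // u ^ (q + 1) = 1} = q + 1 := by
  have e : {u : E // u ^ (q + 1) = 1} ≃ (powMonoidHom (q + 1) : Eˣ →* Eˣ).ker :=
    { toFun := fun u => ⟨Units.ofPowEqOne u.1 (q + 1) u.2 q.succ_ne_zero, by
        simp [MonoidHom.mem_ker]⟩
      invFun := fun u => ⟨u.1, by
        have h := u.2
        rw [MonoidHom.mem_ker, powMonoidHom_apply] at h
        rw [← Units.val_pow_eq_pow_val, h, Units.val_one]⟩
      left_inv := fun _ => rfl
      right_inv := fun _ => by ext; rfl }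
  rw [Nat.card_congr e, IsCyclic.card_powMonoidHom_ker, Nat.card_units, Nat.card_eq_fintype_card,
    hE, Nat.gcd_eq_right]
  exact ⟨q - 1, by simpa using Nat.sq_sub_sq q 1⟩

lemma exists_pow_ne_self {q : ℕ} (hq : 1 < q) {E : Type*} [Field E] [Fintype E]
    (hE : Fintype.card E = q ^ 2) : ∃ θ : E, θ ^ q ≠ θ := by
  by_contra! h
  have hdeg : (X ^ q - X : E[X]).natDegree = q := FiniteField.X_pow_card_sub_X_natDegree_eq E hq
  have hne : (X ^ q - X : E[X]) ≠ 0 := FiniteField.X_pow_card_sub_X_ne_zero E hq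
  have hle := card_le_degree_of_subset_roots (p := (X ^ q - X : E[X])) (Z := Finset.univ)
    fun θ _ => by simp [mem_roots hne, h θ]
  rw [hdeg, Finset.card_univ, hE] at hle
  nlinarith

lemma sub_pow_of_card_eq_sq {q : ℕ} (hq : IsPrimePow q) {E : Type*} [Field E] [Fintype E]
    (hE : Fintype.card E = q ^ 2) (x y : E) : (x - y) ^ q = x ^ q - y ^ q := by
  obtain ⟨p, n, hp, -, rfl⟩ := hq
  have : Fact p.Prime := ⟨hp.nat_prime⟩
  rw [← pow_mul] at hE
  have : CharP E p := charP_of_card_eq_prime_pow hE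
  exact sub_pow_expChar_pow x y n

/-- The fixed points of the semilinear involution `f ↦ u * (f ∘ rev) ^ q` form an `F_q`-structure
on `E ^ k`, so there are `q ^ k` of them. -/
lemma card_fixed_rev {q : ℕ} (hq : IsPrimePow q) {E : Type*} [Field E] [Fintype E]
    (hE : Fintype.card E = q ^ 2) (k : ℕ) {u : E} (hu : u ^ (q + 1) = 1) :
    Nat.card {f : Fin k → E // ∀ j, u * f (Fin.rev j) ^ q = f j} = q ^ k := by
  obtain ⟨θ, hθ⟩ := exists_pow_ne_self hq.one_lt hE
  have hsub := sub_pow_of_card_eq_sq hq hE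
  have hqq (x : E) : (x ^ q) ^ q = x := by
    rw [← pow_mul, ← sq, ← hE, FiniteField.pow_card]
  have hd : θ - θ ^ q ≠ 0 := sub_ne_zero.mpr hθ.symm
  set S := {f : Fin k → E // ∀ j, u * f (Fin.rev j) ^ q = f j}
  have hT (x : Fin k → E) (j : Fin k) : u * (u * x j ^ q) ^ q = x j := by
    rw [mul_pow, hqq, ← mul_assoc, ← pow_succ', hu, one_mul]
  have hadd (x y : E) : (x + y) ^ q = x ^ q + y ^ q := by
    have h := hsub (x + y) y
    rw [add_sub_cancel_right] at h
    rw [h, sub_add_cancel]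
  have hinj : Function.Injective fun w : S × S => fun j => w.1.1 j + θ * w.2.1 j := by
    rintro ⟨⟨a, ha⟩, ⟨b, hb⟩⟩ ⟨⟨a', ha'⟩, ⟨b', hb'⟩⟩ h
    have h1 (j : Fin k) : a j + θ * b j = a' j + θ * b' j := congrFun h j
    have h2 (j : Fin k) : a j + θ ^ q * b j = a' j + θ ^ q * b' j := by
      have := congrArg (fun x => u * x ^ q) (h1 (Fin.rev j))
      simp only [hadd, mul_pow] at this
      linear_combination this - ha j - θ ^ q * hb j + ha' j + θ ^ q * hb' j
    have hbb (j : Fin k) : b j = b' j :=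
      mul_left_cancel₀ hd (by linear_combination h1 j - h2 j)
    have haa (j : Fin k) : a j = a' j := by
      linear_combination h1 j - θ * hbb j
    simp only [Prod.mk.injEq]
    exact ⟨Subtype.ext (funext haa), Subtype.ext (funext hbb)⟩
  have hsurj : Function.Surjective fun w : S × S => fun j => w.1.1 j + θ * w.2.1 j := by
    intro x
    have hpow (j : Fin k) : ((x j - u * x (Fin.rev j) ^ q) / (θ - θ ^ q)) ^ q =
        (x j ^ q - (u * x (Fin.rev j) ^ q) ^ q) / (θ ^ q - θ) := by
      rw [div_pow, hsub, hsub, hqq]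
    have hd' : θ ^ q - θ ≠ 0 := sub_ne_zero.mpr hθ
    have hv (j : Fin k) :
        u * ((x (Fin.rev j) - u * x (Fin.rev (Fin.rev j)) ^ q) / (θ - θ ^ q)) ^ q =
          (x j - u * x (Fin.rev j) ^ q) / (θ - θ ^ q) := by
      rw [hpow, Fin.rev_rev, mul_div_assoc', mul_sub, hT, div_eq_div_iff hd' hd]
      ring
    refine ⟨⟨⟨fun j => x j - θ * ((x j - u * x (Fin.rev j) ^ q) / (θ - θ ^ q)), fun j => ?_⟩,
      ⟨fun j => (x j - u * x (Fin.rev j) ^ q) / (θ - θ ^ q), hv⟩⟩, ?_⟩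
    · rw [hsub, mul_pow, mul_sub, mul_left_comm, hv]
      field_simp
      ring
    · funext j
      simp
  have hcard := Nat.card_eq_of_bijective _ ⟨hinj, hsurj⟩
  rw [Nat.card_prod, Nat.card_fun, Nat.card_eq_fintype_card (α := E), hE, Nat.card_fin, ← pow_mul,
    mul_comm 2 k, pow_mul, ← sq] at hcard
  exact Nat.pow_left_injective two_ne_zero hcard

/-- Lemma A4 (first part): the number `Λ_i` of monic self-dual polynomials of
degree `i` in `F_{q^2}[X]`. -/
theorem count_selfdual (q i : ℕ) (hq : IsPrimePow q)
    (E : Type*) [Field E] [Fintype E] (hE : Fintype.card E = q ^ 2) :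
    Nat.card {g : Polynomial E // g.Monic ∧ g.natDegree = i ∧ IsSelfDual q g} =
      if i = 0 then 1 else (q + 1) * q ^ (i - 1) := by
  rcases i with _ | k
  · rw [if_pos rfl, Nat.card_eq_one_iff_exists]
    have h1 : IsSelfDual q (1 : E[X]) := (isSelfDual_iff_coeff q monic_one).2 (by simp)
    exact ⟨⟨1, monic_one, natDegree_one, h1⟩,
      fun g => Subtype.ext (g.2.1.natDegree_eq_zero.1 g.2.2.1)⟩
  · classical
    rw [if_neg k.succ_ne_zero, Nat.add_sub_cancel, Nat.card_congr (selfDualEquiv E q k),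
      Nat.card_sigma, Finset.sum_congr rfl fun u _ => card_fixed_rev hq hE k u.2,
      Finset.sum_const, Finset.card_univ, ← Nat.card_eq_fintype_card, card_pow_succ_eq_one hE,
      smul_eq_mul]
end

section
/- Let q be a prime power and i, j ≥ 0, and let Γ_{i,i+j} be the number of ordered pairs (g, h) with g, h ∈ F_{q^2}[X] monic and self-dual, deg g = i, deg h = i + j, and gcd(g, h) = 1. Then Γ_{i,i+j} = 1 if i = j = 0; Γ_{i,i+j} = q^{j-1}(q+1) if i = 0 and j > 0; Γ_{i,i+j} = (q(q+1)/(q^2+1))·(q^{2i} - q^{2i-2} - 2·(-1)^i) if i > 0 and j = 0; and Γ_{i,i+j} = (q^{j-1}(q+1)(q^2-1)/(q^2+1))·(q^{2i} - (-1)^i) if i > 0 and j > 0. -/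
open Polynomial

namespace SelfDualPoly

variable {E : Type*} [Field E] {q : ℕ} {φ : E →+* E}

theorem dualPoly_eq_reverse_map (hφ : ∀ x, φ x = x ^ q) (g : E[X]) :
    dualPoly q g = (g.map φ).reverse := by
  ext k
  simp only [dualPoly, finsetSum_coeff, coeff_C_mul, coeff_X_pow, coeff_reverse, coeff_map,
    natDegree_map]
  rcases le_or_gt k g.natDegree with hk | hk
  · rw [Finset.sum_eq_single (g.natDegree - k)]
    · rw [revAt_le hk, hφ]
      rw [if_pos (by omega), mul_one]
    · intro b hb hne
      rw [if_neg (by simp at hb; omega), mul_zero]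
    · exact fun h ↦ absurd (Finset.mem_range.2 (by omega)) h
  · rw [revAt_eq_self_of_lt hk, coeff_eq_zero_of_natDegree_lt hk, map_zero]
    exact Finset.sum_eq_zero fun b _ ↦ by rw [if_neg (by omega), mul_zero]

theorem dualPoly_mul (hφ : ∀ x, φ x = x ^ q) (g h : E[X]) :
    dualPoly q (g * h) = dualPoly q g * dualPoly q h := by
  simp only [dualPoly_eq_reverse_map hφ, Polynomial.map_mul, reverse_mul_of_domain]

theorem dualPoly_dvd_dualPoly (hφ : ∀ x, φ x = x ^ q) {g h : E[X]} (hgh : g ∣ h) :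
    dualPoly q g ∣ dualPoly q h := by
  obtain ⟨k, rfl⟩ := hgh
  exact ⟨_, dualPoly_mul hφ g k⟩

theorem natDegree_dualPoly (hφ : ∀ x, φ x = x ^ q) {g : E[X]} (hg : g.coeff 0 ≠ 0) :
    (dualPoly q g).natDegree = g.natDegree := by
  rw [dualPoly_eq_reverse_map hφ, reverse_natDegree, natDegree_map,
    natTrailingDegree_eq_zero.2 (.inr (by simpa using hg)), Nat.sub_zero]

theorem coeff_dualPoly (hφ : ∀ x, φ x = x ^ q) (g : E[X]) {k : ℕ} (hk : k ≤ g.natDegree) :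
    (dualPoly q g).coeff k = g.coeff (g.natDegree - k) ^ q := by
  rw [dualPoly_eq_reverse_map hφ, coeff_reverse, natDegree_map, revAt_le hk, coeff_map, hφ]

theorem coeff_zero_ne_zero (hφ : ∀ x, φ x = x ^ q) {g : E[X]} (hg : g ≠ 0)
    (hd : IsSelfDual q g) : g.coeff 0 ≠ 0 := by
  obtain ⟨c, hc, h⟩ := hd
  intro h0
  have := congrArg (fun p ↦ p.coeff 0) h
  simp only [coeff_C_mul, h0, mul_zero, coeff_dualPoly hφ g (Nat.zero_le _), ← hφ] at this
  simp at this
  exact hg this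

theorem isSelfDual_mul (hφ : ∀ x, φ x = x ^ q) {g h : E[X]} (hg : IsSelfDual q g)
    (hh : IsSelfDual q h) : IsSelfDual q (g * h) := by
  obtain ⟨c, hc, h1⟩ := hg
  obtain ⟨d, hd, h2⟩ := hh
  exact ⟨c * d, mul_ne_zero hc hd, by rw [dualPoly_mul hφ, h1, h2, C_mul]; ring⟩

theorem isSelfDual_of_mul (hφ : ∀ x, φ x = x ^ q) {g h : E[X]} (hg0 : g ≠ 0)
    (hg : IsSelfDual q g) (hgh : IsSelfDual q (g * h)) : IsSelfDual q h := by
  obtain ⟨c, hc, h1⟩ := hg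
  obtain ⟨d, hd, h2⟩ := hgh
  refine ⟨d / c, div_ne_zero hd hc, ?_⟩
  rw [dualPoly_mul hφ, h1] at h2
  have hC : (C c : E[X]) ≠ 0 := C_ne_zero.2 hc
  apply mul_left_cancel₀ (mul_ne_zero hC hg0)
  rw [h2, show (C d : E[X]) = C c * C (d / c) by rw [← C_mul, mul_div_cancel₀ _ hc]]
  ring

theorem isSelfDual_of_dualPoly_dvd (hφ : ∀ x, φ x = x ^ q) {g : E[X]} (hg : g.coeff 0 ≠ 0)
    (h : dualPoly q g ∣ g) : IsSelfDual q g := by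
  have hg0 : g ≠ 0 := by rintro rfl; simp at hg
  have hass : Associated g (dualPoly q g) :=
    (associated_of_dvd_of_natDegree_le h hg0 (natDegree_dualPoly hφ hg).ge).symm
  obtain ⟨u, hu⟩ := hass
  obtain ⟨c, hc, hcu⟩ := Polynomial.isUnit_iff.1 u.isUnit
  exact ⟨c, hc.ne_zero, by rw [← hu, ← hcu, mul_comm]⟩

theorem IsSelfDual.dualPoly_dvd {g : E[X]} (hg : IsSelfDual q g) : dualPoly q g ∣ g := by
  obtain ⟨c, hc, h⟩ := hg
  refine ⟨C c⁻¹, ?_⟩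
  rw [h, mul_right_comm, ← C_mul, mul_inv_cancel₀ hc, C_1, one_mul]

theorem exists_common_factor (hφ : ∀ x, φ x = x ^ q) {g h : E[X]} (hgm : g.Monic) (hhm : h.Monic)
    (hg : IsSelfDual q g) (hh : IsSelfDual q h) :
    ∃ d g' h' : E[X], d.Monic ∧ g'.Monic ∧ h'.Monic ∧ IsSelfDual q d ∧ IsSelfDual q g' ∧
      IsSelfDual q h' ∧ IsCoprime g' h' ∧ g = d * g' ∧ h = d * h' := by
  classical
  set d := normalize (EuclideanDomain.gcd g h) with hd
  have hgcd0 : EuclideanDomain.gcd g h ≠ 0 := fun h0 ↦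
    hgm.ne_zero (EuclideanDomain.gcd_eq_zero_iff.1 h0).1
  have hdm : d.Monic := monic_normalize hgcd0
  have hdg : d ∣ g := (normalize_associated _).dvd.trans (EuclideanDomain.gcd_dvd_left _ _)
  have hdh : d ∣ h := (normalize_associated _).dvd.trans (EuclideanDomain.gcd_dvd_right _ _)
  have hd0 : d.coeff 0 ≠ 0 := fun h0 ↦ by
    obtain ⟨k, hk⟩ := hdg
    exact coeff_zero_ne_zero hφ hgm.ne_zero hg (by rw [hk, mul_coeff_zero, h0, zero_mul])
  have hds : IsSelfDual q d := by
    refine isSelfDual_of_dualPoly_dvd hφ hd0 ?_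
    refine (EuclideanDomain.dvd_gcd ?_ ?_).trans (normalize_associated _).symm.dvd
    · exact (dualPoly_dvd_dualPoly hφ hdg).trans (IsSelfDual.dualPoly_dvd hg)
    · exact (dualPoly_dvd_dualPoly hφ hdh).trans (IsSelfDual.dualPoly_dvd hh)
  obtain ⟨g', hg'⟩ := hdg
  obtain ⟨h', hh'⟩ := hdh
  refine ⟨d, g', h', hdm, hdm.of_mul_monic_left (hg' ▸ hgm), hdm.of_mul_monic_left (hh' ▸ hhm),
    hds, isSelfDual_of_mul hφ hdm.ne_zero hds (hg' ▸ hg),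
    isSelfDual_of_mul hφ hdm.ne_zero hds (hh' ▸ hh), ?_, hg', hh'⟩
  obtain ⟨u, hu⟩ := (normalize_associated (EuclideanDomain.gcd g h))
  rw [← hd] at hu
  have hbez := EuclideanDomain.gcd_eq_gcd_ab g h
  obtain ⟨k, hk⟩ : d ∣ EuclideanDomain.gcd g h := ⟨_, hu.symm⟩
  have hku : IsUnit k := by
    have : k = u := mul_left_cancel₀ hdm.ne_zero (hk.symm.trans hu.symm)
    exact this ▸ u.isUnit
  obtain ⟨v, hv⟩ := hku.exists_left_inv
  refine ⟨v * EuclideanDomain.gcdA g h, v * EuclideanDomain.gcdB g h, ?_⟩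
  have : k = g' * EuclideanDomain.gcdA g h + h' * EuclideanDomain.gcdB g h := by
    apply mul_left_cancel₀ hdm.ne_zero
    rw [← hk, mul_add, ← mul_assoc, ← mul_assoc, ← hg', ← hh', hbez]
  rw [← hv, this]
  ring

theorem dvd_of_mul_eq_mul {d d' g g' h h' : E[X]} (hc : IsCoprime g' h')
    (h1 : d * g = d' * g') (h2 : d * h = d' * h') : d ∣ d' := by
  obtain ⟨a, b, hab⟩ := hc
  exact ⟨a * g + b * h, by linear_combination a * (-h1) + b * (-h2) - d' * hab⟩

theorem card_pow_add_one_eq_one [Finite E] (hE : Nat.card E = q ^ 2) :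
    Nat.card {u : E // u ^ (q + 1) = 1} = q + 1 := by
  have hq : q ≠ 0 := by rintro rfl; exact Nat.card_pos.ne' hE
  have h := IsCyclic.card_powMonoidHom_ker (G := Eˣ) (q + 1)
  rw [Nat.card_units, hE, show q ^ 2 - 1 = (q + 1) * (q - 1) from Nat.sq_sub_sq q 1,
    Nat.gcd_eq_right (Dvd.intro _ rfl)] at h
  refine Eq.trans (Nat.card_congr (Equiv.symm (Equiv.ofBijective
    (fun u : (powMonoidHom (q + 1) : Eˣ →* Eˣ).ker ↦
      ⟨((u : Eˣ) : E), by simpa using congrArg Units.val u.2⟩) ⟨?_, ?_⟩))) h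
  · intro u v huv
    exact Subtype.ext (Units.ext (congrArg Subtype.val huv))
  · rintro ⟨u, hu⟩
    have hu0 : u ≠ 0 := by rintro rfl; simp at hu
    exact ⟨⟨Units.mk0 u hu0, Units.ext (by simpa using hu)⟩, rfl⟩

theorem exists_pow_ne_self [Finite E] (hE : Nat.card E = q ^ 2) : ∃ x : E, x ^ q ≠ x := by
  have hq : 1 < q := by
    have := Finite.one_lt_card (α := E)
    rw [hE] at this
    by_contra! h
    interval_cases q <;> simp at this
  obtain ⟨a, ha⟩ := exists_pow_ne_one_of_isCyclic (G := Eˣ) (k := q - 1) (by omega) (by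
    rw [Nat.card_units, hE]
    exact Nat.sub_lt_sub_right hq.le (by nlinarith))
  refine ⟨a, fun h ↦ ha (Units.ext ?_)⟩
  apply mul_right_cancel₀ a.ne_zero
  push_cast
  rw [← pow_succ, Nat.sub_add_cancel hq.le, h, one_mul]

/-- The vectors fixed by the semilinear involution `f ↦ (k ↦ u * f (rev k) ^ q)`. -/
abbrev TwistedPalindrome (q n : ℕ) (u : E) : Type _ :=
  {f : Fin n → E // ∀ k, f k.rev ^ q * u = f k}

theorem card_twistedPalindrome [Finite E] (hφ : ∀ x, φ x = x ^ q) (hE : Nat.card E = q ^ 2)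
    (n : ℕ) {u : E} (hu : u ^ (q + 1) = 1) : Nat.card (TwistedPalindrome q n u) = q ^ n := by
  obtain ⟨θ, hθ⟩ := exists_pow_ne_self hE
  have hθ' : θ - θ ^ q ≠ 0 := sub_ne_zero.2 hθ.symm
  have hqq (x : E) : φ (φ x) = x := by
    have := Fintype.ofFinite E
    rw [hφ, hφ, ← pow_mul, ← sq, ← hE, Nat.card_eq_fintype_card, FiniteField.pow_card]
  have huu : φ u * u = 1 := by rw [hφ, ← pow_succ, hu]
  have hcard : Nat.card (TwistedPalindrome q n u × TwistedPalindrome q n u) =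
      Nat.card (Fin n → E) := by
    simp only [TwistedPalindrome, ← hφ] at *
    refine Nat.card_congr (Equiv.ofBijective (fun P k ↦ P.1.1 k + θ * P.2.1 k) ⟨?_, ?_⟩)
    · rintro ⟨⟨f, hf⟩, ⟨g, hg⟩⟩ ⟨⟨f', hf'⟩, ⟨g', hg'⟩⟩ h
      have h (k) : f k + θ * g k = f' k + θ * g' k := congrFun h k
      have hgg : g = g' := by
        funext k
        have h2 := congrArg φ (h k.rev)
        simp only [map_add, map_mul] at h2
        apply mul_left_cancel₀ hθ'
        linear_combination h k - u * h2 + (hf k) + (φ θ) * (hg k) - (hf' k) - φ θ * (hg' k)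
      subst hgg
      obtain rfl : f = f' := funext fun k ↦ by simpa using h k
      rfl
    · intro v
      set g : Fin n → E := fun k ↦ (v k - φ (v k.rev) * u) / (θ - φ θ) with hg
      have hgk (k) : g k * (θ - φ θ) = v k - φ (v k.rev) * u := div_mul_cancel₀ _ hθ'
      have hgrev (k) : φ (g k.rev) * u = g k := by
        apply mul_right_cancel₀ hθ'
        have := congrArg φ (hgk k.rev)
        simp only [map_mul, map_sub, hqq, Fin.rev_rev] at this
        linear_combination (-u) * this - hgk k + v k * huu
      refine ⟨⟨⟨fun k ↦ v k - θ * g k, fun k ↦ ?_⟩, ⟨g, hgrev⟩⟩, ?_⟩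
      · simp only [map_mul, map_sub]
        linear_combination hgk k - φ θ * hgrev k
      · funext k
        simp
  rw [Nat.card_prod, Nat.card_fun, hE, Nat.card_fin, ← pow_mul, mul_comm 2, pow_mul, ← sq] at hcard
  exact Nat.pow_left_injective two_ne_zero hcard

variable (E q) in
/-- The monic self-dual polynomials of degree `n`. -/
abbrev MonicSelfDual (n : ℕ) : Type _ :=
  {g : E[X] // g.Monic ∧ IsSelfDual q g ∧ g.natDegree = n}

theorem isSelfDual_iff (hφ : ∀ x, φ x = x ^ q) {g : E[X]} {n : ℕ} (hg : g.Monic)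
    (hn : g.natDegree = n + 1) :
    IsSelfDual q g ↔ g.coeff 0 ^ (q + 1) = 1 ∧
      ∀ k < n, g.coeff (n - k) ^ q * g.coeff 0 = g.coeff (k + 1) := by
  have hlead : g.coeff (n + 1) = 1 := by rw [← hn]; exact hg
  constructor
  · rintro ⟨c, hc, h⟩
    have hk (k) (hk : k ≤ n + 1) : g.coeff (n + 1 - k) ^ q = c * g.coeff k := by
      rw [← coeff_C_mul, ← h, coeff_dualPoly hφ g (hn ▸ hk), hn]
    have h0 : 1 = c * g.coeff 0 := by simpa [hlead] using hk 0 (Nat.zero_le _)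
    have h1 : g.coeff 0 ^ q = c := by simpa [hlead] using hk (n + 1) le_rfl
    refine ⟨by rw [pow_succ, h1, ← h0], fun k hkn ↦ ?_⟩
    have := hk (k + 1) (by omega)
    rw [Nat.add_sub_add_right] at this
    rw [this]
    linear_combination (-g.coeff (k + 1)) * h0
  · rintro ⟨h0, hk⟩
    have hc0 : g.coeff 0 ≠ 0 := by intro h; simp [h] at h0
    refine ⟨g.coeff 0 ^ q, pow_ne_zero _ hc0, ?_⟩
    ext k
    rw [coeff_C_mul]
    rcases le_or_gt k (n + 1) with hle | hlt
    · rw [coeff_dualPoly hφ g (hn ▸ hle), hn]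
      rcases k with _ | k
      · simp [hlead, ← pow_succ, h0]
      · rw [Nat.add_sub_add_right]
        rcases (Nat.le_of_succ_le_succ hle).lt_or_eq with hlt | rfl
        · rw [← hk k hlt]
          linear_combination (-g.coeff (n - k) ^ q) * h0
        · simp [hlead]
    · have hk0 : g.coeff k = 0 := coeff_eq_zero_of_natDegree_lt (by omega)
      rw [hk0, mul_zero]
      exact coeff_eq_zero_of_natDegree_lt (by rwa [natDegree_dualPoly hφ hc0, hn])

theorem card_monicSelfDual_zero (hφ : ∀ x, φ x = x ^ q) : Nat.card (MonicSelfDual E q 0) = 1 := by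
  rw [Nat.card_eq_one_iff_unique]
  refine ⟨⟨fun g h ↦ Subtype.ext ?_⟩, ⟨⟨1, monic_one, ⟨1, one_ne_zero, ?_⟩, natDegree_one⟩⟩⟩
  · rw [g.2.1.natDegree_eq_zero.1 g.2.2.2, h.2.1.natDegree_eq_zero.1 h.2.2.2]
  · have : (1 : E[X]).reverse = 1 := by rw [← C_1, reverse_C]
    simp [dualPoly_eq_reverse_map hφ, this]

theorem card_monicSelfDual_succ [Finite E] (hφ : ∀ x, φ x = x ^ q) (hE : Nat.card E = q ^ 2)
    (n : ℕ) : Nat.card (MonicSelfDual E q (n + 1)) = q ^ n * (q + 1) := by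
  have := Fintype.ofFinite {u : E // u ^ (q + 1) = 1}
  have hcard : Nat.card (Σ u : {u : E // u ^ (q + 1) = 1}, TwistedPalindrome q n u.1) =
      q ^ n * (q + 1) := by
    rw [Nat.card_sigma, Finset.sum_congr rfl fun u _ ↦ card_twistedPalindrome hφ hE n u.2,
      Finset.sum_const, smul_eq_mul, Finset.card_univ, ← Nat.card_eq_fintype_card,
      card_pow_add_one_eq_one hE, mul_comm]
  rw [← hcard]
  refine Nat.card_congr (Equiv.ofBijective (fun g ↦
    ⟨⟨g.1.coeff 0, ((isSelfDual_iff hφ g.2.1 g.2.2.2).1 g.2.2.1).1⟩,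
      ⟨fun k ↦ g.1.coeff (k + 1), fun k ↦ ?_⟩⟩) ⟨?_, ?_⟩)
  · dsimp only
    rw [← ((isSelfDual_iff hφ g.2.1 g.2.2.2).1 g.2.2.1).2 k k.2, Fin.val_rev,
      show n - (k + 1) + 1 = n - k by omega]
  · rintro ⟨g, hg, hgs, hgn⟩ ⟨h, hh, hhs, hhn⟩ heq
    have h0 : g.coeff 0 = h.coeff 0 := congrArg (fun s ↦ s.1.1) heq
    have hk (k : Fin n) : g.coeff (k + 1) = h.coeff (k + 1) :=
      congrFun (congrArg (fun s ↦ s.2.1) heq) k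
    refine Subtype.ext (Polynomial.ext fun k ↦ ?_)
    rcases k with _ | k
    · exact h0
    · rcases lt_trichotomy k n with hlt | rfl | hlt
      · exact hk ⟨k, hlt⟩
      · have h1 := hg.coeff_natDegree
        have h2 := hh.coeff_natDegree
        rw [hgn] at h1
        rw [hhn] at h2
        exact h1.trans h2.symm
      · change g.coeff _ = h.coeff _
        rw [coeff_eq_zero_of_natDegree_lt (by omega), coeff_eq_zero_of_natDegree_lt (by omega)]
  · rintro ⟨⟨u, hu⟩, ⟨f, hf⟩⟩
    set r : E[X] := X * (∑ k : Fin n, C (f k) * X ^ (k : ℕ)) + C u with hr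
    have hr0 : r.coeff 0 = u := by simp [hr]
    have hrk (k : Fin n) : r.coeff (k + 1) = f k := by
      simp [hr, coeff_X_mul, coeff_C_succ, finsetSum_coeff, coeff_X_pow, Fin.val_inj]
    have hrdeg : r.degree < (n + 1 : ℕ) := by
      rw [degree_lt_iff_coeff_zero]
      intro m hm
      obtain ⟨m, rfl⟩ : ∃ l, m = l + 1 := ⟨m - 1, by omega⟩
      rw [hr, coeff_add, coeff_X_mul, coeff_C_succ, add_zero, finsetSum_coeff]
      refine Finset.sum_eq_zero fun k _ ↦ ?_
      rw [coeff_C_mul, coeff_X_pow, if_neg (by omega), mul_zero]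
    set g : E[X] := X ^ (n + 1) + r with hg
    have hgm : g.Monic := monic_X_pow_add hrdeg
    have hgn : g.natDegree = n + 1 := by
      rw [hg, natDegree_add_eq_left_of_degree_lt (by rwa [degree_X_pow]), natDegree_X_pow]
    have hg0 : g.coeff 0 = u := by simp [hg, hr0]
    have hgk (k : Fin n) : g.coeff (k + 1) = f k := by
      rw [hg, coeff_add, hrk, coeff_X_pow, if_neg (by omega), zero_add]
    refine ⟨⟨g, hgm, (isSelfDual_iff hφ hgm hgn).2 ⟨by rw [hg0, hu], fun k hk ↦ ?_⟩, hgn⟩, ?_⟩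
    · have := hf ⟨k, hk⟩
      rw [← hgk, ← hgk, Fin.val_rev, show n - ((⟨k, hk⟩ : Fin n) + 1) + 1 = n - k by
        simp only; omega] at this
      rw [hg0, this]
    · exact Sigma.subtype_ext (Subtype.ext hg0) (funext hgk)

variable (E q) in
/-- The coprime pairs of monic self-dual polynomials of degrees `m` and `n`. -/
abbrev CoprimeSelfDualPair (m n : ℕ) : Type _ :=
  {P : E[X] × E[X] // P.1.Monic ∧ P.2.Monic ∧ IsSelfDual q P.1 ∧ IsSelfDual q P.2 ∧
    P.1.natDegree = m ∧ P.2.natDegree = n ∧ IsCoprime P.1 P.2}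

instance [Finite E] (n : ℕ) : Finite (MonicSelfDual E q n) :=
  have : Finite {g : E[X] // g.Monic ∧ g.natDegree = n} :=
    .of_equiv _ ((monicEquivDegreeLT n).trans (degreeLTEquiv E n).toEquiv).symm
  Finite.of_injective (fun g ↦ (⟨g.1, g.2.1, g.2.2.2⟩ : {g : E[X] // g.Monic ∧ g.natDegree = n}))
    fun _ _ h ↦ Subtype.ext (congrArg (fun s ↦ s.1) h)

instance [Finite E] (m n : ℕ) : Finite (CoprimeSelfDualPair E q m n) :=
  Finite.of_injective (fun P ↦ ((⟨P.1.1, P.2.1, P.2.2.2.1, P.2.2.2.2.2.1⟩ : MonicSelfDual E q m),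
    (⟨P.1.2, P.2.2.1, P.2.2.2.2.1, P.2.2.2.2.2.2.1⟩ : MonicSelfDual E q n)))
    fun _ _ h ↦ Subtype.ext (Prod.ext (congrArg (fun s ↦ s.1.1) h) (congrArg (fun s ↦ s.2.1) h))

theorem card_mul_card_eq_sum [Finite E] (hφ : ∀ x, φ x = x ^ q) (n j : ℕ) :
    Nat.card (MonicSelfDual E q n) * Nat.card (MonicSelfDual E q (n + j)) =
      ∑ p ∈ Finset.HasAntidiagonal.antidiagonal n,
        Nat.card (MonicSelfDual E q p.1) * Nat.card (CoprimeSelfDualPair E q p.2 (p.2 + j)) := by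
  rw [← Finset.sum_coe_sort, ← Nat.card_prod]
  simp_rw [← Nat.card_prod]
  rw [← Nat.card_sigma]
  refine Nat.card_congr (Equiv.symm (Equiv.ofBijective (fun s ↦
    (⟨s.2.1.1 * s.2.2.1.1, s.2.1.2.1.mul s.2.2.2.1,
      isSelfDual_mul hφ s.2.1.2.2.1 s.2.2.2.2.2.1, ?_⟩,
     ⟨s.2.1.1 * s.2.2.1.2, s.2.1.2.1.mul s.2.2.2.2.1,
      isSelfDual_mul hφ s.2.1.2.2.1 s.2.2.2.2.2.2.1, ?_⟩)) ⟨?_, ?_⟩))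
  · obtain ⟨⟨p, hp⟩, ⟨d, hd, -, hdn⟩, ⟨P, hg, -, -, -, hgn, -, -⟩⟩ := s
    rw [hd.natDegree_mul hg, hdn, hgn]
    exact Finset.HasAntidiagonal.mem_antidiagonal.1 hp
  · obtain ⟨⟨p, hp⟩, ⟨d, hd, -, hdn⟩, ⟨P, -, hh, -, -, -, hhn, -⟩⟩ := s
    rw [hd.natDegree_mul hh, hdn, hhn, ← add_assoc]
    exact congrArg (· + j) (Finset.HasAntidiagonal.mem_antidiagonal.1 hp)
  · rintro ⟨⟨⟨a, b⟩, hp⟩, ⟨d, hd⟩, ⟨⟨g, h⟩, hP⟩⟩ ⟨⟨⟨a', b'⟩, hp'⟩, ⟨d', hd'⟩, ⟨⟨g', h'⟩, hP'⟩⟩ heq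
    have h1 : d * g = d' * g' := congrArg (fun s ↦ s.1.1) heq
    have h2 : d * h = d' * h' := congrArg (fun s ↦ s.2.1) heq
    obtain rfl : d = d' := eq_of_monic_of_associated hd.1 hd'.1
      (associated_of_dvd_dvd (dvd_of_mul_eq_mul hP'.2.2.2.2.2.2 h1 h2)
        (dvd_of_mul_eq_mul hP.2.2.2.2.2.2 h1.symm h2.symm))
    obtain rfl : g = g' := mul_left_cancel₀ hd.1.ne_zero h1
    obtain rfl : h = h' := mul_left_cancel₀ hd.1.ne_zero h2
    obtain rfl : a = a' := hd.2.2.symm.trans hd'.2.2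
    obtain rfl : b = b' := hP.2.2.2.2.1.symm.trans hP'.2.2.2.2.1
    rfl
  · rintro ⟨⟨g, hg, hgs, hgn⟩, ⟨h, hh, hhs, hhn⟩⟩
    obtain ⟨d, g', h', hd, hg', hh', hds, hgs', hhs', hc, rfl, rfl⟩ :=
      exists_common_factor hφ hg hh hgs hhs
    rw [hd.natDegree_mul hg'] at hgn
    rw [hd.natDegree_mul hh'] at hhn
    exact ⟨⟨⟨(d.natDegree, g'.natDegree), Finset.HasAntidiagonal.mem_antidiagonal.2 hgn⟩, ⟨d, hd, hds, rfl⟩,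
      ⟨(g', h'), hg', hh', hgs', hhs', rfl, by simp only; omega, hc⟩⟩, rfl⟩

theorem card_coprimeSelfDualPair_zero [Finite E] (hφ : ∀ x, φ x = x ^ q) (j : ℕ) :
    Nat.card (CoprimeSelfDualPair E q 0 (0 + j)) = Nat.card (MonicSelfDual E q j) := by
  have h := card_mul_card_eq_sum (E := E) hφ 0 j
  simpa only [Finset.Nat.antidiagonal_zero, Finset.sum_singleton, card_monicSelfDual_zero hφ, one_mul,
    zero_add] using h.symm

theorem card_coprimeSelfDualPair_succ [Finite E] (hφ : ∀ x, φ x = x ^ q) (hE : Nat.card E = q ^ 2)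
    (n j : ℕ) :
    Nat.card (CoprimeSelfDualPair E q (n + 1) (n + 1 + j)) +
      Nat.card (CoprimeSelfDualPair E q n (n + j)) +
      q * (Nat.card (MonicSelfDual E q n) * Nat.card (MonicSelfDual E q (n + j))) =
    Nat.card (MonicSelfDual E q (n + 1)) * Nat.card (MonicSelfDual E q (n + 1 + j)) := by
  have hrec (d : ℕ) : Nat.card (MonicSelfDual E q (d + 1)) =
      q * Nat.card (MonicSelfDual E q d) + if d = 0 then 1 else 0 := by
    rcases d with _ | d
    · simp [card_monicSelfDual_succ hφ hE, card_monicSelfDual_zero hφ]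
    · rw [card_monicSelfDual_succ hφ hE, card_monicSelfDual_succ hφ hE, if_neg d.succ_ne_zero]
      ring
  have hsum : ∑ p ∈ Finset.HasAntidiagonal.antidiagonal n,
      (if p.1 = 0 then 1 else 0) * Nat.card (CoprimeSelfDualPair E q p.2 (p.2 + j)) =
      Nat.card (CoprimeSelfDualPair E q n (n + j)) := by
    rw [Finset.sum_eq_single (0, n)]
    · simp
    · rintro ⟨a, b⟩ hab hne
      rw [Finset.HasAntidiagonal.mem_antidiagonal] at hab
      rw [if_neg, zero_mul]
      rintro rfl
      exact hne (by simpa using hab)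
    · simp
  rw [card_mul_card_eq_sum hφ (n + 1) j, Finset.Nat.sum_antidiagonal_succ,
    card_mul_card_eq_sum hφ n j]
  simp only [hrec, add_mul, Finset.sum_add_distrib, hsum, mul_assoc, ← Finset.mul_sum]
  rw [card_monicSelfDual_zero hφ]
  ring

theorem card_coprimeSelfDualPair_equal_degree [Finite E] (hφ : ∀ x, φ x = x ^ q)
    (hE : Nat.card E = q ^ 2) (n : ℕ) :
    (Nat.card (CoprimeSelfDualPair E q (n + 1) (n + 1 + 0)) : ℚ) * (q ^ 2 + 1) =
      q * (q + 1) * (q ^ (2 * (n + 1)) - q ^ (2 * n) - 2 * (-1) ^ (n + 1)) := by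
  induction n with
  | zero =>
    have h := card_coprimeSelfDualPair_succ (E := E) hφ hE 0 0
    rw [card_coprimeSelfDualPair_zero hφ, zero_add, add_zero, card_monicSelfDual_zero hφ,
      ← zero_add 1, card_monicSelfDual_succ hφ hE] at h
    push_cast [← @Nat.cast_inj ℚ] at h
    simp only [zero_add, add_zero] at h ⊢
    linear_combination (q ^ 2 + 1 : ℚ) * h
  | succ n ih =>
    have h := card_coprimeSelfDualPair_succ (E := E) hφ hE (n + 1) 0
    simp only [add_zero, card_monicSelfDual_succ hφ hE] at h ih ⊢
    push_cast [← @Nat.cast_inj ℚ] at h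
    linear_combination (q ^ 2 + 1 : ℚ) * h - ih

theorem card_coprimeSelfDualPair_lt_degree [Finite E] (hφ : ∀ x, φ x = x ^ q)
    (hE : Nat.card E = q ^ 2) (n j : ℕ) :
    (Nat.card (CoprimeSelfDualPair E q (n + 1) (n + 1 + (j + 1))) : ℚ) * (q ^ 2 + 1) =
      q ^ j * (q + 1) * (q ^ 2 - 1) * (q ^ (2 * (n + 1)) - (-1) ^ (n + 1)) := by
  induction n with
  | zero =>
    have h := card_coprimeSelfDualPair_succ (E := E) hφ hE 0 (j + 1)
    rw [card_coprimeSelfDualPair_zero hφ, zero_add (j + 1), zero_add 1, ← add_assoc,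
      card_monicSelfDual_zero hφ, card_monicSelfDual_succ hφ hE, card_monicSelfDual_succ hφ hE] at h
    rw [← zero_add 1, card_monicSelfDual_succ hφ hE] at h
    push_cast [← @Nat.cast_inj ℚ] at h
    simp only [zero_add, add_assoc] at h ⊢
    linear_combination (q ^ 2 + 1 : ℚ) * h
  | succ n ih =>
    have h := card_coprimeSelfDualPair_succ (E := E) hφ hE (n + 1) (j + 1)
    simp only [← add_assoc, card_monicSelfDual_succ hφ hE] at h ih ⊢
    push_cast [← @Nat.cast_inj ℚ] at h
    linear_combination (q ^ 2 + 1 : ℚ) * h - ih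

end SelfDualPoly

/-- Lemma A5: the number `Γ_{i,i+j}` of ordered pairs of coprime monic self-dual
polynomials in `F_{q^2}[X]` of degrees `i` and `i + j`. -/
theorem count_coprime_selfdual_pairs (q i j : ℕ) (hq : IsPrimePow q)
    (E : Type*) [Field E] [Fintype E] (hE : Fintype.card E = q ^ 2) :
    (i = 0 → j = 0 →
      Nat.card {P : Polynomial E × Polynomial E //
          P.1.Monic ∧ P.2.Monic ∧ IsSelfDual q P.1 ∧ IsSelfDual q P.2 ∧
          P.1.natDegree = i ∧ P.2.natDegree = i + j ∧ IsCoprime P.1 P.2} = 1) ∧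
    (i = 0 → 0 < j →
      Nat.card {P : Polynomial E × Polynomial E //
          P.1.Monic ∧ P.2.Monic ∧ IsSelfDual q P.1 ∧ IsSelfDual q P.2 ∧
          P.1.natDegree = i ∧ P.2.natDegree = i + j ∧ IsCoprime P.1 P.2} =
        q ^ (j - 1) * (q + 1)) ∧
    (0 < i → j = 0 →
      (Nat.card {P : Polynomial E × Polynomial E //
          P.1.Monic ∧ P.2.Monic ∧ IsSelfDual q P.1 ∧ IsSelfDual q P.2 ∧
          P.1.natDegree = i ∧ P.2.natDegree = i + j ∧ IsCoprime P.1 P.2} : ℚ) =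
        ((q : ℚ) * ((q : ℚ) + 1) / ((q : ℚ) ^ 2 + 1)) *
          ((q : ℚ) ^ (2 * i) - (q : ℚ) ^ (2 * i - 2) - 2 * (-1 : ℚ) ^ i)) ∧
    (0 < i → 0 < j →
      (Nat.card {P : Polynomial E × Polynomial E //
          P.1.Monic ∧ P.2.Monic ∧ IsSelfDual q P.1 ∧ IsSelfDual q P.2 ∧
          P.1.natDegree = i ∧ P.2.natDegree = i + j ∧ IsCoprime P.1 P.2} : ℚ) =
        ((q : ℚ) ^ (j - 1) * ((q : ℚ) + 1) * ((q : ℚ) ^ 2 - 1) / ((q : ℚ) ^ 2 + 1)) *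
          ((q : ℚ) ^ (2 * i) - (-1 : ℚ) ^ i)) := by
  obtain ⟨p, k, hp, -, rfl⟩ := hq
  have : Fact p.Prime := ⟨hp.nat_prime⟩
  rw [← pow_mul] at hE
  have := charP_of_card_eq_prime_pow hE
  rw [pow_mul, ← Nat.card_eq_fintype_card] at hE
  have hφ (x : E) : iterateFrobenius E p k x = x ^ p ^ k := iterateFrobenius_def ..
  have hpos : ((p ^ k : ℕ) : ℚ) ^ 2 + 1 ≠ 0 := by positivity
  refine ⟨?_, ?_, ?_, ?_⟩
  · rintro rfl rfl
    exact (SelfDualPoly.card_coprimeSelfDualPair_zero hφ 0).trans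
      (SelfDualPoly.card_monicSelfDual_zero hφ)
  · rintro rfl hj
    obtain ⟨j, rfl⟩ := Nat.exists_eq_succ_of_ne_zero hj.ne'
    exact (SelfDualPoly.card_coprimeSelfDualPair_zero hφ _).trans
      (SelfDualPoly.card_monicSelfDual_succ hφ hE j)
  · rintro hi rfl
    obtain ⟨i, rfl⟩ := Nat.exists_eq_succ_of_ne_zero hi.ne'
    rw [div_mul_eq_mul_div, eq_div_iff hpos]
    exact SelfDualPoly.card_coprimeSelfDualPair_equal_degree hφ hE i
  · intro hi hj
    obtain ⟨i, rfl⟩ := Nat.exists_eq_succ_of_ne_zero hi.ne'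
    obtain ⟨j, rfl⟩ := Nat.exists_eq_succ_of_ne_zero hj.ne'
    rw [div_mul_eq_mul_div, eq_div_iff hpos]
    exact SelfDualPoly.card_coprimeSelfDualPair_lt_degree hφ hE i j
end

section
/- Let F_q be a finite field of characteristic p, let f ∈ F_q[X], and suppose f(X) = Σ_{j=0}^{p-1} g_j(X^p - X)·X^j with g_0, …, g_{p-1} ∈ F_q[X]. Define the difference operator Δ on F_q[X] by (Δf)(X) = f(X+1) - f(X). Then for every i with 0 ≤ i ≤ p-1, the i-fold iterate Δ^i f = 0 if and only if g_j = 0 for all j with i ≤ j ≤ p-1. -/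
open Polynomial

namespace Polynomial

variable {R : Type*} [CommRing R]

/-- The forward difference operator `h(X) ↦ h(X + 1) - h(X)` as a linear map. -/
noncomputable def delta (R : Type*) [CommRing R] : R[X] →ₗ[R] R[X] where
  toFun h := h.comp (X + 1) - h
  map_add' a b := by simp only [add_comp]; ring
  map_smul' r a := by simp [smul_comp, smul_sub]

lemma delta_apply (h : R[X]) : delta R h = h.comp (X + 1) - h := rfl

lemma delta_pow_comp (n : ℕ) (h y : R[X]) :
    ((delta R ^ n) h).comp y = (fwdDiff 1)^[n] (fun z : R[X] ↦ h.comp z) y := by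
  induction n generalizing h with
  | zero => simp
  | succ n ih =>
    rw [pow_succ, Module.End.mul_apply, ih, Function.iterate_succ_apply]
    have : (fun z : R[X] ↦ (delta R h).comp z) = fwdDiff 1 fun z ↦ h.comp z := by
      funext z
      simp [delta_apply, fwdDiff, comp_assoc]
    rw [this]

lemma delta_pow_X_pow_of_lt {j n : ℕ} (h : j < n) : (delta R ^ n) (X ^ j) = 0 := by
  have := delta_pow_comp n (X ^ j : R[X]) X
  simpa [fwdDiff_iter_pow_eq_zero_of_lt h] using this

lemma delta_pow_X_pow_self (n : ℕ) :
    (delta R ^ n) (X ^ n) = (n.factorial : R[X]) := by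
  have := delta_pow_comp n (X ^ n : R[X]) X
  simpa [fwdDiff_iter_eq_factorial] using this

lemma delta_pow_mul_of_comp_eq {c : R[X]} (hc : c.comp (X + 1) = c) (n : ℕ) (h : R[X]) :
    (delta R ^ n) (c * h) = c * (delta R ^ n) h := by
  induction n generalizing h with
  | zero => simp
  | succ n ih =>
    have : delta R (c * h) = c * delta R h := by simp [delta_apply, hc, mul_sub]
    rw [pow_succ, Module.End.mul_apply, this, ih, Module.End.mul_apply]

lemma comp_X_pow_char_sub_X_comp_X_add_one (p : ℕ) [Fact p.Prime] [CharP R p] (g : R[X]) :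
    (g.comp (X ^ p - X)).comp (X + 1) = g.comp (X ^ p - X) := by
  rw [comp_assoc]
  congr 1
  simp [add_pow_char]

lemma comp_X_pow_sub_X_ne_zero {K : Type*} [Field K] {p : ℕ} (hp : 1 < p) {g : K[X]} (hg : g ≠ 0) :
    g.comp (X ^ p - X) ≠ 0 := by
  intro h
  rcases comp_eq_zero_iff.mp h with h | ⟨-, h⟩
  · exact hg h
  · have hd := FiniteField.X_pow_card_sub_X_natDegree_eq K hp
    rw [h, natDegree_C] at hd
    omega

end Polynomial

/-- Lemma 5.1: let `F_q` have characteristic `p` and write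
`f(X) = Σ_{j=0}^{p-1} g_j(X^p - X)·X^j`. With `Δf = f(X+1) - f(X)`, for
`0 ≤ i ≤ p - 1` the iterate `Δ^i f = 0` iff `g_j = 0` for all `i ≤ j ≤ p-1`. -/
theorem delta_iterate_eq_zero_iff (q p : ℕ) (hq : IsPrimePow q)
    (F : Type*) [Field F] [Fintype F] (hF : Fintype.card F = q) [CharP F p]
    (f : Polynomial F) (g : ℕ → Polynomial F)
    (hf : f = ∑ j ∈ Finset.range p,
      (g j).comp (Polynomial.X ^ p - Polynomial.X) * Polynomial.X ^ j)
    (i : ℕ) (hi : i ≤ p - 1) :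
    (fun h : Polynomial F => h.comp (Polynomial.X + 1) - h)^[i] f = 0 ↔
      ∀ j, i ≤ j → j ≤ p - 1 → g j = 0 := by
  have : Fact p.Prime := ⟨CharP.char_is_prime F p⟩
  have hp : 1 < p := (Fact.out : p.Prime).one_lt
  have hD : (fun h : F[X] ↦ h.comp (X + 1) - h)^[i] f = (delta F ^ i) f := by
    rw [Module.End.pow_apply]
    rfl
  have hexpand (n : ℕ) : (delta F ^ n) f =
      ∑ j ∈ Finset.range p, (g j).comp (X ^ p - X) * (delta F ^ n) (X ^ j) := by
    rw [hf, map_sum]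
    exact Finset.sum_congr rfl fun j _ ↦
      delta_pow_mul_of_comp_eq (comp_X_pow_char_sub_X_comp_X_add_one p (g j)) n _
  rw [hD]
  constructor
  · intro h0
    by_contra! hne
    obtain ⟨j, hij, hjp, hgj⟩ := hne
    let P : ℕ → Prop := fun j ↦ g j ≠ 0
    classical
    let m := Nat.findGreatest P (p - 1)
    have hgm : g m ≠ 0 := Nat.findGreatest_spec (P := P) hjp hgj
    have hjm : j ≤ m := Nat.le_findGreatest hjp hgj
    have hmp : m ≤ p - 1 := Nat.findGreatest_le _
    have hzero : (delta F ^ m) f = 0 := by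
      rw [← Nat.sub_add_cancel (hij.trans hjm), pow_add, Module.End.mul_apply, h0, map_zero]
    rw [hexpand, Finset.sum_eq_single_of_mem m (Finset.mem_range.mpr (by omega)),
      delta_pow_X_pow_self] at hzero
    · rcases mul_eq_zero.mp hzero with h | h
      · exact comp_X_pow_sub_X_ne_zero hp hgm h
      · rw [CharP.cast_eq_zero_iff F[X] p, (Fact.out : p.Prime).dvd_factorial] at h
        omega
    · intro k hk hkm
      rcases lt_or_gt_of_ne hkm with h | h
      · rw [delta_pow_X_pow_of_lt h, mul_zero]
      · have hgk : g k = 0 := by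
          simpa [P] using Nat.findGreatest_is_greatest (P := P) h
            (Nat.le_sub_one_of_lt (Finset.mem_range.mp hk))
        rw [hgk, zero_comp, zero_mul]
  · intro h
    rw [hexpand]
    refine Finset.sum_eq_zero fun k hk ↦ ?_
    rcases lt_or_ge k i with hki | hik
    · rw [delta_pow_X_pow_of_lt hki, mul_zero]
    · rw [h k hik (Nat.le_sub_one_of_lt (Finset.mem_range.mp hk)), zero_comp, zero_mul]
end
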